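/- arXiv:1009.1359 — 3 statements merged into one kernel-verified Lean document; each statement's English description precedes it below -/
import Mathlib

section
/- Let d ≥ 1 and let M be the uncentered maximal operator on (ℝ^d, ‖·‖_∞) associated to ℓ∞ balls, acting on Lipschitz functions with respect to the ℓ∞ norm. Then ‖M‖_{Op(1)} = d/(d+1) − (1/(d+1)) · max_{0 < s < 1} { s − 2^d s^{d+1}/(1+s)^d }, and the maximum over s is attained at a unique interior point of (0,1). -/
open MeasureTheory Set Filter Topology

/-- The closed ball of the norm-like function `N`, with center `c` and radius `R`. -/
def nball {d : ℕ} (N : (Fin d → ℝ) → ℝ) (c : Fin d → ℝ) (R : ℝ) : Set (Fin d → ℝ) :=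
  {y | N (y - c) ≤ R}

/-- The uncentered Hardy–Littlewood maximal function associated to the norm `N`,
with respect to `d`-dimensional Lebesgue measure. -/
noncomputable def maxFn {d : ℕ} (N : (Fin d → ℝ) → ℝ) (f : (Fin d → ℝ) → ℝ)
    (x : Fin d → ℝ) : ℝ :=
  sSup {a : ℝ | ∃ c : Fin d → ℝ, ∃ R : ℝ, 0 < R ∧ x ∈ nball N c R ∧
    a = ⨍ y in nball N c R, |f y|}

/-- The modulus of continuity of `g`, with distances measured using `N`. -/
noncomputable def modCont {d : ℕ} (N : (Fin d → ℝ) → ℝ) (g : (Fin d → ℝ) → ℝ) (δ : ℝ) : ℝ :=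
  sSup {a : ℝ | ∃ x y : Fin d → ℝ, N (x - y) ≤ δ ∧ a = |g x - g y|}

/-- `N` is a norm on `ℝ^d`. -/
structure IsNorm {d : ℕ} (N : (Fin d → ℝ) → ℝ) : Prop where
  eq_zero_iff : ∀ x, N x = 0 ↔ x = 0
  add_le : ∀ x y, N (x + y) ≤ N x + N y
  smul : ∀ (a : ℝ) (x), N (a • x) = |a| * N x

/-- `ω` is a modulus of continuity: continuous, nondecreasing, subadditive on `[0,∞)`,
vanishing at `0`, nonnegative, and not identically zero. -/
structure IsModulus (ω : ℝ → ℝ) : Prop where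
  nonneg : ∀ t, 0 ≤ t → 0 ≤ ω t
  map_zero : ω 0 = 0
  mono : MonotoneOn ω (Ici 0)
  subadd : ∀ a b, 0 ≤ a → 0 ≤ b → ω (a + b) ≤ ω a + ω b
  cont : ContinuousOn ω (Ici 0)
  nontrivial : ∃ t, 0 < t ∧ ω t ≠ 0

/-- The `Lip(ω)` seminorm of `f`: `sup_{t>0} ω(f,t)/ω(t)`. -/
noncomputable def lipNorm {d : ℕ} (N : (Fin d → ℝ) → ℝ) (ω : ℝ → ℝ)
    (f : (Fin d → ℝ) → ℝ) : ℝ :=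
  sSup {a : ℝ | ∃ t : ℝ, 0 < t ∧ a = modCont N f t / ω t}

/-- The operator norm of the uncentered maximal operator on `Lip(ω)`. -/
noncomputable def opNorm (d : ℕ) (N : (Fin d → ℝ) → ℝ) (ω : ℝ → ℝ) : ℝ :=
  sSup {a : ℝ | ∃ f : (Fin d → ℝ) → ℝ, lipNorm N ω f = 1 ∧ a = lipNorm N ω (maxFn N f)}

/-- The Hölder `α` seminorm of `f`, distances measured with `N`. -/
noncomputable def holderNorm {d : ℕ} (N : (Fin d → ℝ) → ℝ) (α : ℝ)
    (f : (Fin d → ℝ) → ℝ) : ℝ :=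
  sSup {a : ℝ | ∃ x y : Fin d → ℝ, x ≠ y ∧ a = |f x - f y| / N (x - y) ^ α}

/-- The operator norm of the uncentered maximal operator on the Hölder class `Lip_α`. -/
noncomputable def opNormHolder (d : ℕ) (N : (Fin d → ℝ) → ℝ) (α : ℝ) : ℝ :=
  sSup {a : ℝ | ∃ f : (Fin d → ℝ) → ℝ, holderNorm N α f = 1 ∧
    a = holderNorm N α (maxFn N f)}

/-- The function maximized in the formula for the operator norm. -/
noncomputable def cubeGap (d : ℕ) (s : ℝ) : ℝ := s - 2 ^ d * s ^ (d + 1) / (1 + s) ^ d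

lemma cubeGap_eq (d : ℕ) {s : ℝ} (hs : 0 < 1 + s) :
    cubeGap d s = s - 2 ^ d * ((1 + s) * (s / (1 + s)) ^ (d + 1)) := by
  unfold cubeGap
  rw [div_pow, pow_succ (1 + s)]
  field_simp

lemma cubeGap_pos {d : ℕ} (hd : 1 ≤ d) {s : ℝ} (hs : s ∈ Ioo (0 : ℝ) 1) : 0 < cubeGap d s := by
  obtain ⟨h0, h1⟩ := hs
  have h : (2 * s) ^ d < (1 + s) ^ d := pow_lt_pow_left₀ (by linarith) (by positivity) (by omega)
  have h2 : (2 * s) ^ d / (1 + s) ^ d < 1 := (div_lt_one (by positivity)).2 h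
  have h3 : cubeGap d s = s * (1 - (2 * s) ^ d / (1 + s) ^ d) := by
    unfold cubeGap; rw [mul_pow]; ring
  rw [h3]
  exact mul_pos h0 (by linarith)

lemma cubeGap_lt_one {d : ℕ} {s : ℝ} (hs : s ∈ Ioo (0 : ℝ) 1) : cubeGap d s < 1 := by
  obtain ⟨h0, h1⟩ := hs
  have : 0 ≤ 2 ^ d * s ^ (d + 1) / (1 + s) ^ d := by positivity
  unfold cubeGap
  linarith

lemma one_sub_cubeGap_div_nonneg {d : ℕ} (hd : 1 ≤ d) {s : ℝ} (hs : s ∈ Ioo (0 : ℝ) 1) :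
    0 ≤ 1 - (1 + cubeGap d s) / (d + 1) := by
  have hd' : (1 : ℝ) ≤ d := by exact_mod_cast hd
  rw [sub_nonneg, div_le_one (by positivity)]
  linarith [cubeGap_lt_one (d := d) hs]

lemma cubeGap_midpoint_lt {d : ℕ} (hd : 1 ≤ d) {a b : ℝ} (ha : 0 < a) (hb : 0 < b)
    (hab : a ≠ b) : (cubeGap d a + cubeGap d b) / 2 < cubeGap d ((a + b) / 2) := by
  rw [cubeGap_eq d (by positivity), cubeGap_eq d (by positivity), cubeGap_eq d (by positivity)]
  have hne : a / (1 + a) ≠ b / (1 + b) := by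
    intro h
    rw [div_eq_div_iff (by positivity) (by positivity)] at h
    exact hab (by linarith)
  have hconv := (strictConvexOn_pow (n := d + 1) (by omega)).2
    (show a / (1 + a) ∈ Ici (0 : ℝ) from (by positivity : (0 : ℝ) ≤ a / (1 + a)))
    (show b / (1 + b) ∈ Ici (0 : ℝ) from (by positivity : (0 : ℝ) ≤ b / (1 + b))) hne
    (show 0 < (1 + a) / (2 + a + b) by positivity) (show 0 < (1 + b) / (2 + a + b) by positivity)
    (by field_simp; ring)
  simp only [smul_eq_mul] at hconv
  have hmid : (1 + a) / (2 + a + b) * (a / (1 + a)) + (1 + b) / (2 + a + b) * (b / (1 + b)) =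
      (a + b) / 2 / (1 + (a + b) / 2) := by
    field_simp
    ring
  rw [hmid] at hconv
  have hscale := mul_lt_mul_of_pos_left hconv (show 0 < 1 + (a + b) / 2 by positivity)
  have hsum : (1 + (a + b) / 2) * ((1 + a) / (2 + a + b) * (a / (1 + a)) ^ (d + 1) +
      (1 + b) / (2 + a + b) * (b / (1 + b)) ^ (d + 1)) =
      ((1 + a) * (a / (1 + a)) ^ (d + 1) + (1 + b) * (b / (1 + b)) ^ (d + 1)) / 2 := by
    generalize (a / (1 + a)) ^ (d + 1) = A
    generalize (b / (1 + b)) ^ (d + 1) = B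
    field_simp
    ring
  rw [hsum] at hscale
  have := mul_lt_mul_of_pos_left hscale (show (0 : ℝ) < 2 ^ d by positivity)
  linarith

lemma existsUnique_cubeGap_max {d : ℕ} (hd : 1 ≤ d) :
    ∃! s : ℝ, s ∈ Ioo (0 : ℝ) 1 ∧ ∀ r ∈ Ioo (0 : ℝ) 1, cubeGap d r ≤ cubeGap d s := by
  have hcont : ContinuousOn (cubeGap d) (Icc 0 1) := by
    unfold cubeGap
    refine ContinuousOn.sub continuousOn_id (ContinuousOn.div (by fun_prop) (by fun_prop) ?_)
    intro x hx
    have := hx.1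
    positivity
  obtain ⟨s, hs, hmax⟩ := isCompact_Icc.exists_isMaxOn (nonempty_Icc.2 zero_le_one) hcont
  have hpos : 0 < cubeGap d s :=
    (cubeGap_pos hd (s := 1 / 2) (by constructor <;> norm_num)).trans_le
      (hmax (by constructor <;> norm_num))
  have hs0 : s ≠ 0 := by
    rintro rfl
    simp [cubeGap] at hpos
  have hs1 : s ≠ 1 := by
    rintro rfl
    norm_num [cubeGap] at hpos
  refine ⟨s, ⟨⟨lt_of_le_of_ne hs.1 hs0.symm, lt_of_le_of_ne hs.2 hs1⟩,
    fun r hr => hmax (Ioo_subset_Icc_self hr)⟩, ?_⟩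
  rintro t ⟨ht, htmax⟩
  by_contra hne
  have hs' : s ∈ Ioo (0 : ℝ) 1 := ⟨lt_of_le_of_ne hs.1 hs0.symm, lt_of_le_of_ne hs.2 hs1⟩
  have h1 := cubeGap_midpoint_lt hd ht.1 hs'.1 hne
  have h2 := htmax ((t + s) / 2) ⟨by linarith [ht.1, hs'.1], by linarith [ht.2, hs'.2]⟩
  have h3 := hmax (show (t + s) / 2 ∈ Icc (0 : ℝ) 1 from
    ⟨by linarith [ht.1, hs'.1], by linarith [ht.2, hs'.2]⟩)
  simp only [mem_ofPred_eq] at h3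
  linarith

lemma integral_add_min_pow (d : ℕ) {s : ℝ} (h0 : 0 ≤ s) (h1 : s ≤ 1) :
    ∫ r in (0 : ℝ)..1, (r + min r s) ^ d =
      ((1 + s) ^ (d + 1) - 2 ^ d * s ^ (d + 1)) / (d + 1) := by
  have hint : ∀ a b : ℝ, IntervalIntegrable (fun r : ℝ => (r + min r s) ^ d) volume a b :=
    fun a b => (by fun_prop : Continuous fun r : ℝ => (r + min r s) ^ d).intervalIntegrable a b
  rw [← intervalIntegral.integral_add_adjacent_intervals (hint 0 s) (hint s 1)]
  have e1 : ∫ r in (0 : ℝ)..s, (r + min r s) ^ d = ∫ r in (0 : ℝ)..s, 2 ^ d * r ^ d := by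
    refine intervalIntegral.integral_congr fun r hr => ?_
    rw [uIcc_of_le h0] at hr
    simp only [min_eq_left hr.2]
    rw [← mul_pow]; ring
  have e2 : ∫ r in s..1, (r + min r s) ^ d = ∫ r in s..1, (r + s) ^ d := by
    refine intervalIntegral.integral_congr fun r hr => ?_
    rw [uIcc_of_le h1] at hr
    simp only [min_eq_right hr.1]
  rw [e1, e2, intervalIntegral.integral_const_mul, integral_pow,
    intervalIntegral.integral_comp_add_right (fun x => x ^ d), integral_pow]
  have : (0 : ℝ) ^ (d + 1) = 0 := by simp
  rw [this, ← two_mul, mul_pow]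
  ring

lemma nball_norm {d : ℕ} (c : Fin d → ℝ) (R : ℝ) :
    nball (fun x => ‖x‖) c R = Metric.closedBall c R := by
  ext y
  simp [nball, dist_eq_norm]

lemma setAverage_closedBall {d : ℕ} (c : Fin d → ℝ) {R : ℝ} (hR : 0 < R) (g : (Fin d → ℝ) → ℝ) :
    ⨍ z in Metric.closedBall c R, g z =
      ⨍ w in Metric.closedBall (0 : Fin d → ℝ) 1, g (c + R • w) := by
  have h1 : ∫ z in Metric.closedBall c R, g z =
      ∫ z in Metric.closedBall (0 : Fin d → ℝ) R, g (c + z) := by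
    rw [← (measurePreserving_add_left volume c).setIntegral_preimage_emb
      (measurableEmbedding_addLeft c)]
    congr 2
    ext z
    simp
  have h2 := Measure.setIntegral_comp_smul_of_pos volume (fun z => g (c + z))
    (Metric.closedBall (0 : Fin d → ℝ) 1) hR
  rw [smul_closedBall _ _ zero_le_one, smul_zero, Real.norm_of_nonneg hR.le, mul_one] at h2
  rw [setAverage_eq, setAverage_eq, h2, h1, Measure.addHaar_real_closedBall' _ _ hR.le, mul_inv,
    smul_smul, mul_comm]

lemma volume_real_closedBall_pi {d : ℕ} (c : Fin d → ℝ) {R : ℝ} (hR : 0 ≤ R) :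
    volume.real (Metric.closedBall c R) = (2 * R) ^ d := by
  rw [Measure.real, Real.volume_pi_closedBall _ hR, Fintype.card_fin,
    ENNReal.toReal_ofReal (by positivity)]

lemma volume_real_closedBall_inter {d : ℕ} (c : Fin d → ℝ) {R r : ℝ} (hR : 0 ≤ R) (hr : 0 ≤ r) :
    volume.real (Metric.closedBall c R ∩ Metric.closedBall 0 r) =
      ∏ i, max (min (c i + R) r - max (c i - R) (-r)) 0 := by
  have : Metric.closedBall c R ∩ Metric.closedBall 0 r =
      Icc (fun i => max (c i - R) (-r)) (fun i => min (c i + R) r) := by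
    ext z
    simp only [mem_inter_iff, Metric.mem_closedBall, dist_pi_le_iff hR, dist_pi_le_iff hr,
      Real.dist_eq, abs_le, mem_Icc, Pi.le_def, Pi.zero_apply, sub_zero, max_le_iff, le_min_iff,
      ← forall_and]
    refine forall_congr' fun i => ?_
    constructor
    · rintro ⟨⟨_, _⟩, _, _⟩
      refine ⟨⟨?_, ?_⟩, ?_, ?_⟩ <;> linarith
    · rintro ⟨⟨_, _⟩, _, _⟩
      refine ⟨⟨?_, ?_⟩, ?_, ?_⟩ <;> linarith
  rw [this, Measure.real, Real.volume_Icc_pi, ENNReal.toReal_prod]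
  simp only [ENNReal.toReal_ofReal']

lemma setIntegral_cone_eq {d : ℕ} (c : Fin d → ℝ) (R : ℝ) :
    ∫ z in Metric.closedBall c R, max (1 - ‖z‖) 0 =
      ∫ r in (0 : ℝ)..1, volume.real (Metric.closedBall c R ∩ Metric.closedBall 0 r) := by
  have hcont : Continuous fun z : Fin d → ℝ => max (1 - ‖z‖) 0 := by fun_prop
  rw [Integrable.integral_eq_integral_meas_le
    (hcont.continuousOn.integrableOn_compact (isCompact_closedBall c R))
    (Eventually.of_forall fun z => le_max_right _ _)]
  have hsub := intervalIntegral.integral_comp_sub_left (a := 0) (b := 1)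
    (fun r => volume.real (Metric.closedBall c R ∩ Metric.closedBall 0 r)) 1
  rw [sub_self, sub_zero] at hsub
  rw [← hsub, intervalIntegral.integral_of_le zero_le_one,
    ← setIntegral_eq_of_subset_of_forall_sdiff_eq_zero measurableSet_Ioi
      (Ioc_subset_Ioi_self : Ioc (0 : ℝ) 1 ⊆ Ioi 0)]
  · refine setIntegral_congr_fun measurableSet_Ioi fun t ht => ?_
    have ht : 0 < t := ht
    have hset : {a : Fin d → ℝ | t ≤ max (1 - ‖a‖) 0} = Metric.closedBall 0 (1 - t) := by
      ext z
      simp only [mem_ofPred_eq, le_max_iff, mem_closedBall_zero_iff]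
      constructor
      · rintro (h | h) <;> linarith
      · intro h
        exact Or.inl (by linarith)
    simp only [hset]
    rw [measureReal_restrict_apply Metric.isClosed_closedBall.measurableSet, inter_comm]
  · rintro t ⟨ht, ht'⟩
    have ht : 0 < t := ht
    have ht1 : 1 - t < 0 := by
      by_contra h
      exact ht' ⟨ht, by linarith⟩
    simp [Metric.closedBall_eq_empty.2 ht1]

lemma setAverage_cone_le {d : ℕ} (c : Fin d → ℝ) {R : ℝ} (hR : 0 < R) {h : ℝ → ℝ}
    (hcont : Continuous h) (h0 : ∀ r ∈ Icc (0 : ℝ) 1, 0 ≤ h r)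
    (hle : ∀ r ∈ Icc (0 : ℝ) 1, ∀ i, min (c i + R) r - max (c i - R) (-r) ≤ h r) :
    ⨍ z in Metric.closedBall c R, max (1 - ‖z‖) 0 ≤ (∫ r in (0 : ℝ)..1, h r ^ d) / (2 * R) ^ d := by
  rw [setAverage_eq, setIntegral_cone_eq, volume_real_closedBall_pi c hR.le, smul_eq_mul,
    inv_mul_eq_div]
  gcongr
  refine intervalIntegral.integral_mono_on zero_le_one (Monotone.intervalIntegrable ?_)
    ((hcont.pow d).intervalIntegrable 0 1) fun r hr => ?_
  · intro r r' hrr'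
    refine measureReal_mono (inter_subset_inter_right _ (Metric.closedBall_subset_closedBall hrr'))
      (measure_ne_top_of_subset inter_subset_left
        (isCompact_closedBall c R).measure_lt_top.ne)
  · rw [volume_real_closedBall_inter c hR.le hr.1]
    calc ∏ i, max (min (c i + R) r - max (c i - R) (-r)) 0 ≤ ∏ _i : Fin d, h r :=
          Finset.prod_le_prod (fun i _ => le_max_right _ _)
            fun i _ => max_le (hle r hr i) (h0 r hr)
      _ = h r ^ d := by simp

lemma setAverage_cone_le_of_one_mem {d : ℕ} (hd : 1 ≤ d) {s : ℝ} (hs : s ∈ Ioo (0 : ℝ) 1)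
    (hmax : ∀ r ∈ Ioo (0 : ℝ) 1, cubeGap d r ≤ cubeGap d s) {c : Fin d → ℝ} {R : ℝ} (hR : 0 < R)
    (hc : (fun _ => 1) ∈ Metric.closedBall c R) :
    ⨍ z in Metric.closedBall c R, max (1 - ‖z‖) 0 ≤ (1 + cubeGap d s) / (d + 1) := by
  have hci : ∀ i, 1 - 2 * R ≤ c i - R ∧ 1 ≤ c i + R := by
    intro i
    have := (dist_pi_le_iff hR.le).1 (Metric.mem_closedBall.1 hc) i
    rw [Real.dist_eq, abs_le] at this
    constructor <;> linarith [this.1, this.2]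
  by_cases hmid : 2 * R - 1 ∈ Ioo (0 : ℝ) 1
  · have h := setAverage_cone_le c hR (h := fun r => r + min r (2 * R - 1)) (by fun_prop)
      (fun r hr => add_nonneg hr.1 (le_min hr.1 hmid.1.le)) (fun r hr i => by
        rw [← sub_le_iff_le_add', le_min_iff]
        have h1 := min_le_right (c i + R) r
        have h2 := le_max_left (c i - R) (-r)
        have h3 := le_max_right (c i - R) (-r)
        have := hci i
        constructor <;> linarith)
    refine h.trans (le_trans (le_of_eq ?_)
      (div_le_div_of_nonneg_right (add_le_add_right (hmax _ hmid) 1) (by positivity)))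
    rw [integral_add_min_pow d hmid.1.le hmid.2.le]
    unfold cubeGap
    rw [show 1 + (2 * R - 1) = 2 * R by ring, pow_succ (2 * R)]
    field_simp
    ring
  · have h := setAverage_cone_le c hR (h := fun r => 2 * R * r) (by fun_prop)
      (fun r hr => mul_nonneg (by positivity) hr.1) (fun r hr i => by
        have h1 := min_le_right (c i + R) r
        have h2 := le_max_left (c i - R) (-r)
        have h3 := le_max_right (c i - R) (-r)
        have := hci i
        rcases le_or_gt (2 * R) 1 with h4 | h4
        · nlinarith [hr.1, hr.2]
        · have h5 : 1 ≤ R := by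
            by_contra h6
            exact hmid ⟨by linarith, by linarith⟩
          nlinarith [hr.1, hr.2])
    refine h.trans (le_trans (le_of_eq (b := 1 / ((d : ℝ) + 1)) ?_)
      (div_le_div_of_nonneg_right (by linarith [cubeGap_pos hd hs]) (by positivity)))
    simp_rw [mul_pow (2 * R)]
    rw [intervalIntegral.integral_const_mul, integral_pow]
    field_simp
    simp

lemma setAverage_cone_corner {d : ℕ} {s : ℝ} (hs : s ∈ Ioo (0 : ℝ) 1) {e : Fin d → ℝ}
    (he : ∀ i, e i = (1 - s) / 2 ∨ e i = -((1 - s) / 2)) :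
    ⨍ z in Metric.closedBall e ((1 + s) / 2), max (1 - ‖z‖) 0 = (1 + cubeGap d s) / (d + 1) := by
  obtain ⟨hs0, hs1⟩ := hs
  have hR : 0 ≤ (1 + s) / 2 := by positivity
  rw [setAverage_eq, setIntegral_cone_eq, volume_real_closedBall_pi e hR]
  have : ∫ r in (0 : ℝ)..1, volume.real (Metric.closedBall e ((1 + s) / 2) ∩ Metric.closedBall 0 r)
      = ∫ r in (0 : ℝ)..1, (r + min r s) ^ d := by
    refine intervalIntegral.integral_congr fun r hr => ?_
    rw [uIcc_of_le zero_le_one] at hr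
    obtain ⟨hr0, hr1⟩ := hr
    rw [volume_real_closedBall_inter e hR hr0]
    have hfac : ∀ i, max (min (e i + (1 + s) / 2) r - max (e i - (1 + s) / 2) (-r)) 0 =
        r + min r s := by
      intro i
      rw [max_eq_left]
      · rcases he i with h | h <;> rw [h]
        · rw [show (1 - s) / 2 + (1 + s) / 2 = 1 by ring,
            show (1 - s) / 2 - (1 + s) / 2 = -s by ring, min_eq_right hr1, max_neg_neg, min_comm]
          ring
        · rw [show -((1 - s) / 2) + (1 + s) / 2 = s by ring,
            show -((1 - s) / 2) - (1 + s) / 2 = -1 by ring, max_eq_right (by linarith), min_comm]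
          ring
      · rw [sub_nonneg, max_le_iff, le_min_iff, le_min_iff]
        rcases he i with h | h <;> rw [h] <;> refine ⟨⟨?_, ?_⟩, ?_, ?_⟩ <;> linarith
    simp [hfac]
  rw [this, integral_add_min_pow d hs0.le hs1.le, smul_eq_mul]
  unfold cubeGap
  rw [show 2 * ((1 + s) / 2) = 1 + s by ring, pow_succ (1 + s)]
  field_simp
  ring

lemma setAverage_norm_corner {d : ℕ} {s : ℝ} (hs : s ∈ Ioo (0 : ℝ) 1) {e : Fin d → ℝ}
    (he : ∀ i, e i = (1 - s) / 2 ∨ e i = -((1 - s) / 2)) :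
    ⨍ w in Metric.closedBall (0 : Fin d → ℝ) 1, ‖e + ((1 + s) / 2) • w‖ =
      1 - (1 + cubeGap d s) / (d + 1) := by
  have hR : 0 < (1 + s) / 2 := by linarith [hs.1]
  have hnorm : ‖e‖ ≤ (1 - s) / 2 := by
    refine (pi_norm_le_iff_of_nonneg (by linarith [hs.2])).2 fun i => ?_
    rw [Real.norm_eq_abs, abs_le]
    rcases he i with h | h <;> rw [h] <;> constructor <;> linarith [hs.2]
  rw [← setAverage_cone_corner hs he, setAverage_closedBall e hR]
  have hcongr : ∀ w ∈ Metric.closedBall (0 : Fin d → ℝ) 1,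
      ‖e + ((1 + s) / 2) • w‖ = 1 - max (1 - ‖e + ((1 + s) / 2) • w‖) 0 := by
    intro w hw
    have h1 : ‖e + ((1 + s) / 2) • w‖ ≤ 1 := by
      refine (norm_add_le _ _).trans ?_
      rw [norm_smul, Real.norm_of_nonneg hR.le]
      have := mem_closedBall_zero_iff.1 hw
      nlinarith
    rw [max_eq_left (by linarith)]
    ring
  have hvol : volume.real (Metric.closedBall (0 : Fin d → ℝ) 1) = 2 ^ d := by
    rw [volume_real_closedBall_pi _ zero_le_one, mul_one]
  have hcont : Continuous fun w : Fin d → ℝ => max (1 - ‖e + ((1 + s) / 2) • w‖) 0 := by fun_prop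
  rw [setAverage_eq, setAverage_eq,
    setIntegral_congr_fun Metric.isClosed_closedBall.measurableSet hcongr,
    integral_sub (continuous_const.continuousOn.integrableOn_compact (isCompact_closedBall _ _))
      (hcont.continuousOn.integrableOn_compact (isCompact_closedBall _ _)),
    setIntegral_const, hvol, smul_sub, smul_smul, inv_mul_cancel₀ (by positivity), one_smul]

lemma exists_closedBall_average_le {d : ℕ} {s : ℝ} (hs : s ∈ Ioo (0 : ℝ) 1)
    {f : (Fin d → ℝ) → ℝ} (hf : ∀ x y, |f x - f y| ≤ ‖x - y‖) {x y c : Fin d → ℝ} {R : ℝ}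
    (hR : 0 < R) (hx : x ∈ Metric.closedBall c R) :
    ∃ c' : Fin d → ℝ, ∃ R' : ℝ, 0 < R' ∧ y ∈ Metric.closedBall c' R' ∧
      ⨍ z in Metric.closedBall c R, |f z| ≤
        (⨍ z in Metric.closedBall c' R', |f z|) +
          (1 - (1 + cubeGap d s) / (d + 1)) * ‖x - y‖ := by
  obtain ⟨hs0, hs1⟩ := id hs
  set δ := ‖x - y‖
  have hδ0 : 0 ≤ δ := norm_nonneg _
  let e : Fin d → ℝ := fun i => if 0 ≤ y i - x i then (1 - s) / 2 else -((1 - s) / 2)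
  have he : ∀ i, e i = (1 - s) / 2 ∨ e i = -((1 - s) / 2) := fun i => by
    by_cases h : 0 ≤ y i - x i <;> simp only [e, h, if_true, if_false, true_or, or_true]
  have hfc : Continuous f := by
    refine LipschitzWith.continuous (K := 1) (LipschitzWith.of_dist_le_mul fun x y => ?_)
    simpa [Real.dist_eq, dist_eq_norm] using hf x y
  have hR' : 0 < R + δ * ((1 + s) / 2) := by positivity
  refine ⟨c + δ • e, R + δ * ((1 + s) / 2), hR', ?_, ?_⟩
  · rw [Metric.mem_closedBall, dist_pi_le_iff hR'.le] at *
    intro i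
    have hxi := (dist_pi_le_iff hR.le).1 hx i
    have hyi : |x i - y i| ≤ δ := by
      simpa [Real.norm_eq_abs] using norm_le_pi_norm (x - y) i
    rw [Real.dist_eq, abs_le] at hxi ⊢
    simp only [Pi.add_apply, Pi.smul_apply, smul_eq_mul, e]
    rw [abs_le] at hyi
    split_ifs with h
    · constructor <;> nlinarith
    · constructor <;> nlinarith
  · rw [setAverage_closedBall c hR, setAverage_closedBall _ hR',
      ← setAverage_norm_corner hs he, mul_comm _ δ]
    simp only [setAverage_eq, smul_eq_mul]
    rw [mul_left_comm, ← mul_add]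
    gcongr
    rw [← integral_const_mul, ← integral_add]
    · refine setIntegral_mono_on ?_ ?_ Metric.isClosed_closedBall.measurableSet fun w _ => ?_
      · exact ContinuousOn.integrableOn_compact (isCompact_closedBall _ _) (by fun_prop)
      · exact ContinuousOn.integrableOn_compact (isCompact_closedBall _ _) (by fun_prop)
      · have h1 := hf (c + R • w) (c + δ • e + (R + δ * ((1 + s) / 2)) • w)
        have h2 : ‖c + R • w - (c + δ • e + (R + δ * ((1 + s) / 2)) • w)‖ =
            δ * ‖e + ((1 + s) / 2) • w‖ := by
          rw [← norm_neg, ← Real.norm_of_nonneg hδ0, ← norm_smul, Real.norm_of_nonneg hδ0]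
          congr 1
          module
        rw [h2] at h1
        have h3 := abs_sub_abs_le_abs_sub (f (c + R • w))
          (f (c + δ • e + (R + δ * ((1 + s) / 2)) • w))
        linarith
    · exact ContinuousOn.integrableOn_compact (isCompact_closedBall _ _) (by fun_prop)
    · exact ContinuousOn.integrableOn_compact (isCompact_closedBall _ _) (by fun_prop)

lemma maxFn_le_maxFn_add {d : ℕ} (hd : 1 ≤ d) {s : ℝ} (hs : s ∈ Ioo (0 : ℝ) 1)
    {f : (Fin d → ℝ) → ℝ} (hf : ∀ x y, |f x - f y| ≤ ‖x - y‖) (x y : Fin d → ℝ) :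
    maxFn (fun x => ‖x‖) f x ≤
      maxFn (fun x => ‖x‖) f y + (1 - (1 + cubeGap d s) / (d + 1)) * ‖x - y‖ := by
  have hC := one_sub_cubeGap_div_nonneg hd hs
  unfold maxFn
  simp only [nball_norm]
  have key : ∀ x y : Fin d → ℝ, ∀ a ∈ {a : ℝ | ∃ c : Fin d → ℝ, ∃ R : ℝ, 0 < R ∧
      x ∈ Metric.closedBall c R ∧ a = ⨍ z in Metric.closedBall c R, |f z|},
      ∃ b ∈ {a : ℝ | ∃ c : Fin d → ℝ, ∃ R : ℝ, 0 < R ∧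
      y ∈ Metric.closedBall c R ∧ a = ⨍ z in Metric.closedBall c R, |f z|},
      a ≤ b + (1 - (1 + cubeGap d s) / (d + 1)) * ‖x - y‖ := by
    rintro x y a ⟨c, R, hR, hx, rfl⟩
    obtain ⟨c', R', hR', hy, h⟩ := exists_closedBall_average_le hs hf (y := y) hR hx
    exact ⟨_, ⟨c', R', hR', hy, rfl⟩, h⟩
  have hbdd : ∀ x y : Fin d → ℝ, BddAbove {a : ℝ | ∃ c : Fin d → ℝ, ∃ R : ℝ, 0 < R ∧
      y ∈ Metric.closedBall c R ∧ a = ⨍ z in Metric.closedBall c R, |f z|} →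
      BddAbove {a : ℝ | ∃ c : Fin d → ℝ, ∃ R : ℝ, 0 < R ∧
      x ∈ Metric.closedBall c R ∧ a = ⨍ z in Metric.closedBall c R, |f z|} := by
    rintro x y ⟨M, hM⟩
    refine ⟨M + (1 - (1 + cubeGap d s) / (d + 1)) * ‖x - y‖, fun a ha => ?_⟩
    obtain ⟨b, hb, h⟩ := key x y a ha
    linarith [hM hb]
  by_cases hy : BddAbove {a : ℝ | ∃ c : Fin d → ℝ, ∃ R : ℝ, 0 < R ∧
      y ∈ Metric.closedBall c R ∧ a = ⨍ z in Metric.closedBall c R, |f z|}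
  · refine csSup_le ⟨_, x, 1, one_pos, Metric.mem_closedBall_self zero_le_one, rfl⟩ fun a ha => ?_
    obtain ⟨b, hb, h⟩ := key x y a ha
    exact h.trans (add_le_add_left (le_csSup hy hb) _)
  · rw [Real.sSup_of_not_bddAbove hy, Real.sSup_of_not_bddAbove fun h => hy (hbdd y x h)]
    positivity

lemma abs_sub_le_of_holderNorm_eq_one {d : ℕ} {f : (Fin d → ℝ) → ℝ}
    (hf : holderNorm (fun x => ‖x‖) 1 f = 1) (x y : Fin d → ℝ) : |f x - f y| ≤ ‖x - y‖ := by
  rcases eq_or_ne x y with rfl | hxy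
  · simp
  have hb : BddAbove {a : ℝ | ∃ x y : Fin d → ℝ, x ≠ y ∧ a = |f x - f y| / ‖x - y‖ ^ (1 : ℝ)} := by
    by_contra h
    have := Real.sSup_of_not_bddAbove h
    unfold holderNorm at hf
    linarith
  have h := le_csSup hb ⟨x, y, hxy, rfl⟩
  change _ ≤ holderNorm (fun x => ‖x‖) 1 f at h
  rw [hf, Real.rpow_one, div_le_one (norm_pos_iff.2 (sub_ne_zero.2 hxy))] at h
  exact h

lemma holderNorm_one_mem_upperBounds {d : ℕ} {C : ℝ} {f : (Fin d → ℝ) → ℝ}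
    (hf : ∀ x y, |f x - f y| ≤ C * ‖x - y‖) :
    C ∈ upperBounds
      {a : ℝ | ∃ x y : Fin d → ℝ, x ≠ y ∧ a = |f x - f y| / ‖x - y‖ ^ (1 : ℝ)} := by
  rintro a ⟨x, y, hxy, rfl⟩
  rw [Real.rpow_one, div_le_iff₀ (norm_pos_iff.2 (sub_ne_zero.2 hxy))]
  exact hf x y

lemma holderNorm_one_le {d : ℕ} {C : ℝ} (hC : 0 ≤ C) {f : (Fin d → ℝ) → ℝ}
    (hf : ∀ x y, |f x - f y| ≤ C * ‖x - y‖) : holderNorm (fun x => ‖x‖) 1 f ≤ C :=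
  Real.sSup_le (holderNorm_one_mem_upperBounds hf) hC

lemma le_holderNorm_one {d : ℕ} {C : ℝ} {f : (Fin d → ℝ) → ℝ}
    (hf : ∀ x y, |f x - f y| ≤ C * ‖x - y‖) {x y : Fin d → ℝ} (hxy : x ≠ y) :
    |f x - f y| / ‖x - y‖ ≤ holderNorm (fun x => ‖x‖) 1 f :=
  le_csSup ⟨C, holderNorm_one_mem_upperBounds hf⟩ ⟨x, y, hxy, by rw [Real.rpow_one]⟩

lemma abs_cone_sub_cone_le {d : ℕ} (x y : Fin d → ℝ) :
    |max (1 - ‖x‖) 0 - max (1 - ‖y‖) 0| ≤ ‖x - y‖ :=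
  calc |max (1 - ‖x‖) 0 - max (1 - ‖y‖) 0| ≤ |(1 - ‖x‖) - (1 - ‖y‖)| :=
        abs_max_sub_max_le_abs _ _ _
    _ = |‖y‖ - ‖x‖| := by congr 1; ring
    _ ≤ ‖x - y‖ := by rw [norm_sub_rev]; exact abs_norm_sub_norm_le y x

lemma one_le_maxFn_cone {d : ℕ} :
    1 ≤ maxFn (fun x => ‖x‖) (fun z : Fin d → ℝ => max (1 - ‖z‖) 0) 0 := by
  have hle : ∀ (c : Fin d → ℝ) (R : ℝ), 0 < R →
      ⨍ z in Metric.closedBall c R, |max (1 - ‖z‖) 0| ≤ 1 ∧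
      ∀ L : ℝ, (∀ z ∈ Metric.closedBall c R, L ≤ |max (1 - ‖z‖) 0|) →
        L ≤ ⨍ z in Metric.closedBall c R, |max (1 - ‖z‖) 0| := by
    intro c R hR
    have hvol : 0 < volume.real (Metric.closedBall c R) := by
      rw [volume_real_closedBall_pi c hR.le]
      positivity
    have hint : ∀ g : (Fin d → ℝ) → ℝ, Continuous g → IntegrableOn g (Metric.closedBall c R) :=
      fun g hg => hg.continuousOn.integrableOn_compact (isCompact_closedBall _ _)
    have hcont : Continuous fun z : Fin d → ℝ => |max (1 - ‖z‖) 0| := by fun_prop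
    rw [setAverage_eq, smul_eq_mul, inv_mul_eq_div]
    constructor
    · rw [div_le_one hvol]
      have := setIntegral_mono_on (hint _ hcont) (hint (fun _ => (1 : ℝ)) continuous_const)
        Metric.isClosed_closedBall.measurableSet fun z _ => by
          rw [abs_of_nonneg (le_max_right _ _)]
          exact max_le (by linarith [norm_nonneg z]) zero_le_one
      simpa using this
    · intro L hL
      rw [le_div_iff₀ hvol]
      have := setIntegral_mono_on (hint (fun _ => L) continuous_const) (hint _ hcont)
        Metric.isClosed_closedBall.measurableSet hL
      simpa [mul_comm] using this
  refine le_of_forall_pos_le_add fun ε hε => ?_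
  have hb : BddAbove {a : ℝ | ∃ c : Fin d → ℝ, ∃ R : ℝ, 0 < R ∧
      0 ∈ nball (fun x => ‖x‖) c R ∧
      a = ⨍ z in nball (fun x => ‖x‖) c R, |max (1 - ‖z‖) 0|} := by
    refine ⟨1, ?_⟩
    rintro a ⟨c, R, hR, -, rfl⟩
    rw [nball_norm]
    exact (hle c R hR).1
  have h := le_csSup hb ⟨0, ε, hε, by simp [nball, hε.le], rfl⟩
  rw [nball_norm] at h
  have h2 := (hle 0 ε hε).2 (1 - ε) fun z hz => by
    have := mem_closedBall_zero_iff.1 hz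
    exact le_trans (le_trans (by linarith) (le_max_left _ _)) (le_abs_self _)
  have h3 := h2.trans h
  unfold maxFn
  linarith

lemma maxFn_cone_one_le {d : ℕ} (hd : 1 ≤ d) {s : ℝ} (hs : s ∈ Ioo (0 : ℝ) 1)
    (hmax : ∀ r ∈ Ioo (0 : ℝ) 1, cubeGap d r ≤ cubeGap d s) :
    maxFn (fun x => ‖x‖) (fun z : Fin d → ℝ => max (1 - ‖z‖) 0) (fun _ => 1) ≤
      (1 + cubeGap d s) / (d + 1) := by
  have hpos := cubeGap_pos hd hs
  refine Real.sSup_le ?_ (by positivity)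
  rintro a ⟨c, R, hR, hc, rfl⟩
  rw [nball_norm] at *
  simp only [abs_of_nonneg (le_max_right (1 - ‖_‖) (0 : ℝ))]
  exact setAverage_cone_le_of_one_mem hd hs hmax hR hc

lemma opNormHolder_norm_one {d : ℕ} (hd : 1 ≤ d) {s : ℝ} (hs : s ∈ Ioo (0 : ℝ) 1)
    (hmax : ∀ r ∈ Ioo (0 : ℝ) 1, cubeGap d r ≤ cubeGap d s) :
    opNormHolder d (fun x => ‖x‖) 1 = 1 - (1 + cubeGap d s) / (d + 1) := by
  have hC := one_sub_cubeGap_div_nonneg hd hs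
  have hlip : ∀ f : (Fin d → ℝ) → ℝ, (∀ x y, |f x - f y| ≤ ‖x - y‖) → ∀ x y,
      |maxFn (fun x => ‖x‖) f x - maxFn (fun x => ‖x‖) f y| ≤
        (1 - (1 + cubeGap d s) / (d + 1)) * ‖x - y‖ := by
    intro f hf x y
    have h1 := maxFn_le_maxFn_add hd hs hf x y
    have h2 := maxFn_le_maxFn_add hd hs hf y x
    rw [norm_sub_rev y x] at h2
    rw [abs_le]
    constructor <;> linarith
  have hub : 1 - (1 + cubeGap d s) / (d + 1) ∈ upperBounds {a : ℝ | ∃ f : (Fin d → ℝ) → ℝ,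
      holderNorm (fun x => ‖x‖) 1 f = 1 ∧
      a = holderNorm (fun x => ‖x‖) 1 (maxFn (fun x => ‖x‖) f)} := by
    rintro a ⟨f, hf, rfl⟩
    exact holderNorm_one_le hC (hlip f (abs_sub_le_of_holderNorm_eq_one hf))
  refine le_antisymm (Real.sSup_le hub hC) ?_
  have : Nonempty (Fin d) := ⟨⟨0, hd⟩⟩
  have hnorm : ‖(fun _ => 1 : Fin d → ℝ)‖ = 1 := by simp [pi_norm_const]
  have hne : (0 : Fin d → ℝ) ≠ fun _ => 1 := by
    intro h
    rw [← h, norm_zero] at hnorm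
    exact zero_ne_one hnorm
  have hcone : holderNorm (fun x => ‖x‖) 1 (fun z : Fin d → ℝ => max (1 - ‖z‖) 0) = 1 := by
    have hone : ∀ x y : Fin d → ℝ, |max (1 - ‖x‖) 0 - max (1 - ‖y‖) 0| ≤ 1 * ‖x - y‖ := by
      simpa only [one_mul] using abs_cone_sub_cone_le
    refine le_antisymm (holderNorm_one_le zero_le_one hone) ?_
    have h := le_holderNorm_one hone hne
    simpa [hnorm] using h
  refine le_trans ?_ (le_csSup ⟨_, hub⟩ ⟨_, hcone, rfl⟩)
  refine le_trans ?_ (le_holderNorm_one (hlip _ abs_cone_sub_cone_le) hne)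
  rw [zero_sub, norm_neg, hnorm, div_one]
  refine le_trans ?_ (le_abs_self _)
  have h1 := one_le_maxFn_cone (d := d)
  have h2 := maxFn_cone_one_le hd hs hmax
  linarith

/-- On Lipschitz functions of `(ℝ^d, ‖·‖_∞)`, the operator norm of the maximal operator
associated to `ℓ∞` balls equals `d/(d+1) − (1/(d+1)) max_{0<s<1} (s − 2^d s^{d+1}/(1+s)^d)`,
the maximum being attained at a unique interior point of `(0,1)`. -/
theorem stmt8 (d : ℕ) (hd : 1 ≤ d) :
    (∃! s : ℝ, s ∈ Set.Ioo (0 : ℝ) 1 ∧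
      ∀ r ∈ Set.Ioo (0 : ℝ) 1,
        r - 2 ^ d * r ^ (d + 1) / (1 + r) ^ d ≤ s - 2 ^ d * s ^ (d + 1) / (1 + s) ^ d) ∧
    ∀ s ∈ Set.Ioo (0 : ℝ) 1,
      (∀ r ∈ Set.Ioo (0 : ℝ) 1,
        r - 2 ^ d * r ^ (d + 1) / (1 + r) ^ d ≤ s - 2 ^ d * s ^ (d + 1) / (1 + s) ^ d) →
      opNormHolder d (fun x => ‖x‖) 1 =
        (d : ℝ) / (d + 1) - (1 / (d + 1)) * (s - 2 ^ d * s ^ (d + 1) / (1 + s) ^ d) := by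
  refine ⟨existsUnique_cubeGap_max hd, fun s hs hmax => ?_⟩
  rw [opNormHolder_norm_one hd hs hmax]
  unfold cubeGap
  field_simp
  ring
end

section
/- Let M be the uncentered Hardy–Littlewood maximal operator on ℝ (averages over intervals containing the point). Then on the Lipschitz functions of ℝ, ‖M‖_{Op(1)} = √2 − 1; that is, for every Lipschitz f : ℝ → ℝ one has Lip(Mf) ≤ (√2 − 1) Lip(f), and the constant √2 − 1 is attained (it is the supremum of Lip(Mf) over f with Lip(f) = 1). -/
open MeasureTheory Set

/-- The uncentered Hardy–Littlewood maximal function on `ℝ` (averages of `|f|` over bounded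
intervals containing the point). -/
noncomputable def maxR (f : ℝ → ℝ) (x : ℝ) : ℝ :=
  sSup {a : ℝ | ∃ p q : ℝ, p < q ∧ x ∈ Set.Icc p q ∧ a = ⨍ y in Set.Icc p q, |f y|}

/-- The Lipschitz constant of `f : ℝ → ℝ`. -/
noncomputable def lipR (f : ℝ → ℝ) : ℝ :=
  sSup {a : ℝ | ∃ x y : ℝ, x ≠ y ∧ a = |f x - f y| / |x - y|}

theorem integral_const_add_sub_left (α a b : ℝ) :
    ∫ t in a..b, (α + (t - a)) = α * (b - a) + (b - a) ^ 2 / 2 := by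
  have h : ∀ t ∈ uIcc a b, HasDerivAt (fun t : ℝ => α * t + (t - a) ^ 2 / 2) (α + (t - a)) t := by
    intro t _
    have := ((hasDerivAt_id t).const_mul α).add
      ((((hasDerivAt_id t).sub_const a).pow 2).div_const 2)
    refine this.congr_deriv ?_
    simp
  rw [intervalIntegral.integral_eq_sub_of_hasDerivAt h
    (Continuous.intervalIntegrable (by fun_prop) _ _)]
  ring

theorem integral_const_add_sub_right (α a b : ℝ) :
    ∫ t in a..b, (α + (b - t)) = α * (b - a) + (b - a) ^ 2 / 2 := by
  have h : ∀ t ∈ uIcc a b, HasDerivAt (fun t : ℝ => α * t - (b - t) ^ 2 / 2) (α + (b - t)) t := by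
    intro t _
    have := ((hasDerivAt_id t).const_mul α).sub
      ((((hasDerivAt_id t).const_sub b).pow 2).div_const 2)
    refine this.congr_deriv ?_
    simp
    ring
  rw [intervalIntegral.integral_eq_sub_of_hasDerivAt h
    (Continuous.intervalIntegrable (by fun_prop) _ _)]
  ring

theorem continuous_of_abs_sub_le {f : ℝ → ℝ} {C : ℝ} (hf : ∀ x y, |f x - f y| ≤ C * |x - y|) :
    Continuous f := by
  have : LipschitzWith (Real.toNNReal C) f := by
    refine LipschitzWith.of_dist_le_mul fun x y => ?_
    rw [Real.dist_eq, Real.dist_eq]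
    exact (hf x y).trans (mul_le_mul_of_nonneg_right (Real.le_coe_toNNReal C) (abs_nonneg _))
  exact this.continuous

section OneLipschitz

variable {g : ℝ → ℝ}

theorem integral_le_of_left (hg : ∀ x y, |g x - g y| ≤ |x - y|) {a b : ℝ} (hab : a ≤ b) :
    ∫ t in a..b, g t ≤ g a * (b - a) + (b - a) ^ 2 / 2 := by
  have hc : Continuous g := continuous_of_abs_sub_le (C := 1) (by simpa using hg)
  rw [← integral_const_add_sub_left]
  refine intervalIntegral.integral_mono_on hab (hc.intervalIntegrable _ _)
    (Continuous.intervalIntegrable (by fun_prop) _ _) fun t ht => ?_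
  have h1 := (abs_le.1 (hg t a)).2
  rw [abs_of_nonneg (sub_nonneg.2 ht.1)] at h1
  linarith

theorem integral_le_of_right (hg : ∀ x y, |g x - g y| ≤ |x - y|) {a b : ℝ} (hab : a ≤ b) :
    ∫ t in a..b, g t ≤ g b * (b - a) + (b - a) ^ 2 / 2 := by
  have hc : Continuous g := continuous_of_abs_sub_le (C := 1) (by simpa using hg)
  rw [← integral_const_add_sub_right]
  refine intervalIntegral.integral_mono_on hab (hc.intervalIntegrable _ _)
    (Continuous.intervalIntegrable (by fun_prop) _ _) fun t ht => ?_
  have h1 := (abs_le.1 (hg b t)).1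
  rw [abs_of_nonneg (sub_nonneg.2 ht.2)] at h1
  linarith

theorem le_integral_of_left (hg : ∀ x y, |g x - g y| ≤ |x - y|) {a b : ℝ} (hab : a ≤ b) :
    g a * (b - a) - (b - a) ^ 2 / 2 ≤ ∫ t in a..b, g t := by
  have h := integral_le_of_left (g := fun t => -g t)
    (fun x y => by rw [← abs_neg]; convert hg x y using 2; ring) hab
  rw [intervalIntegral.integral_neg] at h
  linarith

theorem le_integral_of_right (hg : ∀ x y, |g x - g y| ≤ |x - y|) {a b : ℝ} (hab : a ≤ b) :
    g b * (b - a) - (b - a) ^ 2 / 2 ≤ ∫ t in a..b, g t := by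
  have h := integral_le_of_right (g := fun t => -g t)
    (fun x y => by rw [← abs_neg]; convert hg x y using 2; ring) hab
  rw [intervalIntegral.integral_neg] at h
  linarith

/-- If all integrals of a `1`-Lipschitz function over `[0, u]` are nonpositive, the function grows
at most with slope `√2 - 1`. -/
theorem le_sqrt_two_sub_one_mul (hg : ∀ x y, |g x - g y| ≤ |x - y|)
    (hG : ∀ u, 0 ≤ u → ∫ t in (0 : ℝ)..u, g t ≤ 0) {m : ℝ} (hm : 0 ≤ m) :
    g m ≤ (√2 - 1) * m := by
  have hc : Continuous g := continuous_of_abs_sub_le (C := 1) (by simpa using hg)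
  by_contra! hlt
  have h2 : √2 ^ 2 = 2 := Real.sq_sqrt (by norm_num)
  have h1 : 1 < √2 := by rw [Real.lt_sqrt] <;> norm_num
  have hk : 0 < g m := (mul_nonneg (by linarith) hm).trans_lt hlt
  have hl := le_integral_of_right hg hm
  have hr := le_integral_of_left hg (show m ≤ m + g m by linarith)
  have hs := hG (m + g m) (by linarith)
  rw [← intervalIntegral.integral_add_adjacent_intervals (hc.intervalIntegrable 0 m)
    (hc.intervalIntegrable m (m + g m))] at hs
  have key : 0 < (g m - (√2 - 1) * m) * (g m + (√2 + 1) * m) :=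
    mul_pos (by linarith) (by nlinarith)
  nlinarith

/-- A `1`-Lipschitz function whose average over an interval exceeds its value at the right endpoint
needs an interval that is long compared with the difference of its endpoint values. -/
theorem lt_sub_of_mul_lt_integral (hg : ∀ x y, |g x - g y| ≤ |x - y|) {a b : ℝ} (hab : a < b)
    (hle : g a ≤ g b) (hlt : g b * (b - a) < ∫ t in a..b, g t) :
    (√2 + 1) * (g b - g a) < b - a := by
  have hc : Continuous g := continuous_of_abs_sub_le (C := 1) (by simpa using hg)
  have hba := (abs_le.1 (hg b a)).2
  rw [abs_of_pos (sub_pos.2 hab)] at hba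
  have hl := integral_le_of_left hg (show a ≤ a + (b - a + (g b - g a)) / 2 by linarith)
  have hr := integral_le_of_right hg (show a + (b - a + (g b - g a)) / 2 ≤ b by linarith)
  rw [← intervalIntegral.integral_add_adjacent_intervals
    (hc.intervalIntegrable a (a + (b - a + (g b - g a)) / 2)) (hc.intervalIntegrable _ b)] at hlt
  have h2 : √2 ^ 2 = 2 := Real.sq_sqrt (by norm_num)
  have h1 : 1 < √2 := by rw [Real.lt_sqrt] <;> norm_num
  set D := g b - g a with hD
  set L := b - a with hL
  have hga : g a = g b - D := by rw [hD]; ring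
  have hq : 0 < L ^ 2 - 2 * D * L - D ^ 2 := by
    have e1 : b - (a + (L + D) / 2) = (L - D) / 2 := by rw [hL]; ring
    have e2 : a + (L + D) / 2 - a = (L + D) / 2 := by ring
    rw [e1] at hr
    rw [e2, hga] at hl
    nlinarith
  by_contra! hcon
  nlinarith [mul_nonneg (sub_nonneg.2 hcon) (show 0 ≤ L + (√2 - 1) * D by nlinarith)]

/-- If all integrals of a `1`-Lipschitz function over `[0, u]` are nonpositive, then its average
over `[d, e]` is at most `(√2 - 1) * d`. -/
theorem integral_le_sqrt_two_sub_one_mul (hg : ∀ x y, |g x - g y| ≤ |x - y|)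
    (hG : ∀ u, 0 ≤ u → ∫ t in (0 : ℝ)..u, g t ≤ 0) {d e : ℝ} (hd : 0 < d) (hde : d < e) :
    ∫ t in d..e, g t ≤ (√2 - 1) * d * (e - d) := by
  have hc : Continuous g := continuous_of_abs_sub_le (C := 1) (by simpa using hg)
  by_contra! hlt
  have h2 : √2 ^ 2 = 2 := Real.sq_sqrt (by norm_num)
  have h1 : 1 < √2 := by rw [Real.lt_sqrt] <;> norm_num
  set a := (√2 - 1) * d with ha
  have ha0 : 0 < a := mul_pos (by linarith) hd
  have hsplit : ∀ u v w, (∫ t in u..v, g t) + ∫ t in v..w, g t = ∫ t in u..w, g t :=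
    fun u v w => intervalIntegral.integral_add_adjacent_intervals
      (hc.intervalIntegrable _ _) (hc.intervalIntegrable _ _)
  let φ : ℝ → ℝ := fun u => (∫ t in d..u, g t) - a * (u - d)
  have hφ : ∀ u, HasDerivAt φ (g u - a) u := fun u => by
    have := (hc.integral_hasStrictDerivAt d u).hasDerivAt.sub
      (((hasDerivAt_id u).sub_const d).const_mul a)
    exact this.congr_deriv (by simp)
  have hφc : Continuous φ := continuous_iff_continuousAt.2 fun u => (hφ u).continuousAt
  have hφe : 0 < φ e := by simp only [φ]; linarith
  have hφd : φ d = 0 := by simp [φ]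
  obtain ⟨R, heR, hR⟩ : ∃ R, e ≤ R ∧ φ R ≤ 0 := by
    refine ⟨max e (d + -(∫ t in (0 : ℝ)..d, g t) / a), le_max_left _ _, ?_⟩
    set R := max e (d + -(∫ t in (0 : ℝ)..d, g t) / a)
    have hr1 : e ≤ R := le_max_left _ _
    have hr2 : -(∫ t in (0 : ℝ)..d, g t) / a ≤ R - d := by
      have : d + -(∫ t in (0 : ℝ)..d, g t) / a ≤ R := le_max_right _ _
      linarith
    rw [div_le_iff₀ ha0] at hr2
    have := hG R (by linarith)
    rw [← hsplit 0 d R] at this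
    simp only [φ]
    linarith
  obtain ⟨u, hu, hmax⟩ := isCompact_Icc.exists_isMaxOn (nonempty_Icc.2 (hde.le.trans heR))
    hφc.continuousOn
  have hφu : 0 < φ u := hφe.trans_le (hmax ⟨hde.le, heR⟩)
  have hdu : d < u := lt_of_le_of_ne hu.1 fun h => by rw [← h, hφd] at hφu; exact hφu.false
  have huR : u < R := lt_of_le_of_ne hu.2 fun h => by rw [h] at hφu; linarith
  have hgu : g u = a := by
    have := (hmax.isLocalMax (Icc_mem_nhds hdu huR)).hasDerivAt_eq_zero (hφ u)
    linarith
  have hint : a * (u - d) < ∫ t in d..u, g t := by simp only [φ] at hφu; linarith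
  have hlen := lt_sub_of_mul_lt_integral hg hdu
    (hgu ▸ le_sqrt_two_sub_one_mul hg hG hd.le) (hgu ▸ hint)
  have hl := le_integral_of_right hg hd.le
  have hr := le_integral_of_left hg (show u ≤ u + a by linarith)
  have hs := hG (u + a) (by linarith)
  rw [← hsplit 0 u, ← hsplit 0 d u] at hs
  rw [hgu] at hlen hr
  have h3 : a * ((√2 + 1) * (a - g d)) < a * (u - d) := mul_lt_mul_of_pos_left hlen ha0
  have h4 : a * ((√2 + 1) * (a - g d)) = d * (a - g d) := by
    rw [ha]; linear_combination d * ((√2 - 1) * d - g d) * h2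
  have h5 : a ^ 2 + 2 * a * d - d ^ 2 = 0 := by
    rw [ha]; linear_combination d ^ 2 * h2
  nlinarith

end OneLipschitz

theorem integral_le_of_forall_integral_le_right {h : ℝ → ℝ} {K A y : ℝ} (hK : 0 < K)
    (hh : ∀ x y, |h x - h y| ≤ K * |x - y|) (hA : ∀ r < y, ∫ t in r..y, h t ≤ A * (y - r))
    {p q : ℝ} (hpq : p < q) (hqy : q < y) :
    ∫ t in p..q, h t ≤ (A + (√2 - 1) * K * (y - q)) * (q - p) := by
  have hc : Continuous h := continuous_of_abs_sub_le hh
  have hg : ∀ s t, |(h (y - s) - A) / K - (h (y - t) - A) / K| ≤ |s - t| := fun s t => by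
    rw [← sub_div, abs_div, abs_of_pos hK, div_le_iff₀ hK, mul_comm,
      sub_sub_sub_cancel_right]
    have := hh (y - s) (y - t)
    rwa [sub_sub_sub_cancel_left, abs_sub_comm t s] at this
  have hint : ∀ u v, ∫ t in u..v, (h (y - t) - A) / K =
      ((∫ t in (y - v)..(y - u), h t) - A * (v - u)) / K := fun u v => by
    rw [intervalIntegral.integral_div, intervalIntegral.integral_sub
      (Continuous.intervalIntegrable (by fun_prop) _ _) intervalIntegrable_const,
      intervalIntegral.integral_comp_sub_left, intervalIntegral.integral_const, smul_eq_mul]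
    ring
  have := integral_le_sqrt_two_sub_one_mul hg (fun u hu => by
    rw [hint]
    refine div_nonpos_of_nonpos_of_nonneg ?_ hK.le
    rcases hu.eq_or_lt with rfl | hu
    · simp
    · have := hA (y - u) (by linarith)
      simp only [sub_sub_cancel, sub_zero] at this ⊢
      linarith) (sub_pos.2 hqy) (sub_lt_sub_left hpq y)
  rw [hint, div_le_iff₀ hK] at this
  simp only [sub_sub_cancel] at this
  linarith

theorem integral_le_of_forall_integral_le_left {h : ℝ → ℝ} {K A y : ℝ} (hK : 0 < K)
    (hh : ∀ x y, |h x - h y| ≤ K * |x - y|) (hA : ∀ r, y < r → ∫ t in y..r, h t ≤ A * (r - y))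
    {p q : ℝ} (hpq : p < q) (hyp : y < p) :
    ∫ t in p..q, h t ≤ (A + (√2 - 1) * K * (p - y)) * (q - p) := by
  have := integral_le_of_forall_integral_le_right (h := fun t => h (-t)) (A := A) (y := -y) hK
    (fun s t => by
      rw [abs_sub_comm s t]
      convert hh (-s) (-t) using 3
      ring)
    (fun r hr => by
      have := hA (-r) (by linarith)
      rw [intervalIntegral.integral_comp_neg, neg_neg]
      linarith) (neg_lt_neg hpq) (neg_lt_neg hyp)
  rw [intervalIntegral.integral_comp_neg, neg_neg, neg_neg] at this
  linarith

theorem setAverage_Icc_eq_div (h : ℝ → ℝ) {p q : ℝ} (hpq : p < q) :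
    ⨍ y in Icc p q, h y = (∫ y in p..q, h y) / (q - p) := by
  rw [setAverage_eq, integral_Icc_eq_integral_Ioc, ← intervalIntegral.integral_of_le hpq.le,
    Measure.real, Real.volume_Icc, ENNReal.toReal_ofReal (sub_pos.2 hpq).le, smul_eq_mul,
    div_eq_inv_mul]

/-- The averages of `|f|` over the bounded intervals containing `x`. -/
def averagesAt (f : ℝ → ℝ) (x : ℝ) : Set ℝ :=
  {a : ℝ | ∃ p q : ℝ, p < q ∧ x ∈ Set.Icc p q ∧ a = ⨍ y in Set.Icc p q, |f y|}

theorem averagesAt_nonempty (f : ℝ → ℝ) (x : ℝ) : (averagesAt f x).Nonempty :=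
  ⟨_, x, x + 1, by linarith, ⟨le_rfl, by linarith⟩, rfl⟩

theorem mem_averagesAt_le {f : ℝ → ℝ} {K : ℝ} (hK : 0 < K)
    (hf : ∀ x y, |f x - f y| ≤ K * |x - y|) {x y : ℝ} (hy : BddAbove (averagesAt f y))
    {a : ℝ} (ha : a ∈ averagesAt f x) : a ≤ maxR f y + (√2 - 1) * K * |x - y| := by
  obtain ⟨p, q, hpq, hx, rfl⟩ := ha
  have h1 : 1 < √2 := by rw [Real.lt_sqrt] <;> norm_num
  have hcK : 0 ≤ (√2 - 1) * K := mul_nonneg (by linarith) hK.le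
  have hM : ∀ r s, r < s → y ∈ Icc r s → ∫ t in r..s, |f t| ≤ maxR f y * (s - r) :=
    fun r s hrs hmem => by
      rw [← div_le_iff₀ (sub_pos.2 hrs), ← setAverage_Icc_eq_div _ hrs]
      exact le_csSup hy ⟨r, s, hrs, hmem, rfl⟩
  have hh : ∀ s t, |(|f s| - |f t|)| ≤ K * |s - t| := fun s t =>
    (abs_abs_sub_abs_le_abs_sub _ _).trans (hf s t)
  rw [setAverage_Icc_eq_div _ hpq, div_le_iff₀ (sub_pos.2 hpq)]
  rcases lt_or_ge q y with hqy | hqy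
  · refine (integral_le_of_forall_integral_le_right hK hh
      (fun r hr => hM r y hr ⟨hr.le, le_rfl⟩) hpq hqy).trans ?_
    have : y - q ≤ |x - y| := by linarith [neg_abs_le (x - y), hx.2]
    have := sub_pos.2 hpq
    gcongr
  rcases lt_or_ge y p with hyp | hyp
  · refine (integral_le_of_forall_integral_le_left hK hh
      (fun r hr => hM y r hr ⟨le_rfl, hr.le⟩) hpq hyp).trans ?_
    have : p - y ≤ |x - y| := by linarith [le_abs_self (x - y), hx.1]
    have := sub_pos.2 hpq
    gcongr
  · refine (hM p q hpq ⟨hyp, hqy⟩).trans (mul_le_mul_of_nonneg_right ?_ (sub_pos.2 hpq).le)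
    exact le_add_of_nonneg_right (mul_nonneg hcK (abs_nonneg _))

theorem abs_maxR_sub_maxR_le {f : ℝ → ℝ} {K : ℝ} (hK : 0 < K)
    (hf : ∀ x y, |f x - f y| ≤ K * |x - y|) (x y : ℝ) :
    |maxR f x - maxR f y| ≤ (√2 - 1) * K * |x - y| := by
  have hbdd : ∀ u v, BddAbove (averagesAt f u) → BddAbove (averagesAt f v) := fun u v hu =>
    ⟨_, fun a ha => mem_averagesAt_le hK hf hu ha⟩
  by_cases hx : BddAbove (averagesAt f x)
  · have h : ∀ u v, maxR f u ≤ maxR f v + (√2 - 1) * K * |u - v| := fun u v =>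
      csSup_le (averagesAt_nonempty f u) fun a ha => mem_averagesAt_le hK hf (hbdd x v hx) ha
    have h1 := h x y
    have h2 := h y x
    rw [abs_sub_comm y x] at h2
    exact abs_le.2 ⟨by linarith, by linarith⟩
  · have h : ∀ u, maxR f u = 0 := fun u =>
      Real.sSup_of_not_bddAbove fun hu => hx (hbdd u x hu)
    have h1 : 1 < √2 := by rw [Real.lt_sqrt] <;> norm_num
    rw [h, h, sub_zero, abs_zero]
    exact mul_nonneg (mul_nonneg (by linarith) hK.le) (abs_nonneg _)

theorem lipR_le {f : ℝ → ℝ} {C : ℝ} (hf : ∀ x y, |f x - f y| ≤ C * |x - y|) : lipR f ≤ C := by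
  refine csSup_le ⟨_, 0, 1, zero_ne_one, rfl⟩ ?_
  rintro a ⟨x, y, hxy, rfl⟩
  exact (div_le_iff₀ (abs_pos.2 (sub_ne_zero.2 hxy))).2 (hf x y)

theorem div_le_lipR {f : ℝ → ℝ} {C : ℝ} (hf : ∀ x y, |f x - f y| ≤ C * |x - y|) {x y : ℝ}
    (hxy : x ≠ y) : |f x - f y| / |x - y| ≤ lipR f := by
  refine le_csSup ⟨C, ?_⟩ ⟨x, y, hxy, rfl⟩
  rintro a ⟨u, v, huv, rfl⟩
  exact (div_le_iff₀ (abs_pos.2 (sub_ne_zero.2 huv))).2 (hf u v)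

theorem abs_sub_le_lipR_mul {f : ℝ → ℝ} {C : ℝ} (hf : ∀ x y, |f x - f y| ≤ C * |x - y|)
    (x y : ℝ) : |f x - f y| ≤ lipR f * |x - y| := by
  rcases eq_or_ne x y with rfl | hxy
  · simp
  · exact (div_le_iff₀ (abs_pos.2 (sub_ne_zero.2 hxy))).1 (div_le_lipR hf hxy)

theorem lipR_nonneg (f : ℝ → ℝ) : 0 ≤ lipR f :=
  Real.sSup_nonneg fun _ ⟨_, _, _, ha⟩ => ha ▸ div_nonneg (abs_nonneg _) (abs_nonneg _)

theorem lipR_maxR_le {f : ℝ → ℝ} {C : ℝ} (hf : ∀ x y, |f x - f y| ≤ C * |x - y|) :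
    lipR (maxR f) ≤ (√2 - 1) * lipR f := by
  have h1 : 1 < √2 := by rw [Real.lt_sqrt] <;> norm_num
  have hc : 0 < √2 - 1 := by linarith
  refine le_of_forall_pos_le_add fun ε hε => ?_
  have hK : 0 < lipR f + ε / (√2 - 1) := add_pos_of_nonneg_of_pos (lipR_nonneg f) (div_pos hε hc)
  refine (lipR_le (abs_maxR_sub_maxR_le hK fun x y => (abs_sub_le_lipR_mul hf x y).trans ?_)).trans
    (le_of_eq ?_)
  · exact mul_le_mul_of_nonneg_right (le_add_of_nonneg_right (div_pos hε hc).le) (abs_nonneg _)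
  · field_simp

theorem abs_sub_le_of_lipR_eq_one {f : ℝ → ℝ} (hf : lipR f = 1) (x y : ℝ) :
    |f x - f y| ≤ 1 * |x - y| := by
  have hb : BddAbove {a : ℝ | ∃ x y : ℝ, x ≠ y ∧ a = |f x - f y| / |x - y|} := by
    by_contra hb
    rw [lipR, Real.sSup_of_not_bddAbove hb] at hf
    exact zero_ne_one hf
  rcases eq_or_ne x y with rfl | hxy
  · simp
  · rw [← div_le_iff₀ (abs_pos.2 (sub_ne_zero.2 hxy)), ← hf]
    exact le_csSup hb ⟨x, y, hxy, rfl⟩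

/-- The tent function of height and half-width `1` centred at the origin. -/
noncomputable def tent (t : ℝ) : ℝ := max 0 (1 - |t|)

theorem tent_nonneg (t : ℝ) : 0 ≤ tent t := le_max_left _ _

theorem tent_of_abs_le_one {t : ℝ} (ht : |t| ≤ 1) : tent t = 1 - |t| :=
  max_eq_right (sub_nonneg.2 ht)

theorem abs_tent_sub_tent_le (x y : ℝ) : |tent x - tent y| ≤ 1 * |x - y| := by
  rw [one_mul]
  calc |tent x - tent y| ≤ |(1 - |x|) - (1 - |y|)| := by
        rw [tent, tent, max_comm 0, max_comm 0]
        exact abs_max_sub_max_le_abs _ _ _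
    _ = |(|y| - |x|)| := by congr 1; ring
    _ ≤ |x - y| := by rw [abs_sub_comm x y]; exact abs_abs_sub_abs_le_abs_sub _ _

theorem continuous_tent : Continuous tent := continuous_of_abs_sub_le abs_tent_sub_tent_le

theorem lipR_tent : lipR tent = 1 := by
  refine le_antisymm (lipR_le abs_tent_sub_tent_le) ?_
  have := div_le_lipR abs_tent_sub_tent_le (zero_ne_one (α := ℝ))
  simpa [tent] using this

theorem tent_le {t c : ℝ} (h : c ≤ 1) (ht : c ≤ |t|) : tent t ≤ 1 - c :=
  max_le (by linarith) (by linarith)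

theorem integral_tent_le_of_le_one {p : ℝ} (hp : p ≤ 1) :
    ∫ t in p..1, tent t ≤ (1 - (√2 - 1)) * (1 - p) := by
  have h2 : √2 ^ 2 = 2 := Real.sq_sqrt (by norm_num)
  have h1 : 1 < √2 := by rw [Real.lt_sqrt] <;> norm_num
  have h3 : √2 < 2 := by rw [Real.sqrt_lt'] <;> norm_num
  have hi : ∀ a b, IntervalIntegrable tent volume a b := fun a b =>
    continuous_tent.intervalIntegrable a b
  have hout : ∀ a b, a ≤ b → (∀ t ∈ Icc a b, √2 - 1 ≤ |t|) →
      ∫ t in a..b, tent t ≤ (1 - (√2 - 1)) * (b - a) := fun a b hab h => by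
    have := intervalIntegral.integral_mono_on hab (hi a b) intervalIntegrable_const
      fun t ht => tent_le (by linarith) (h t ht)
    rw [intervalIntegral.integral_const, smul_eq_mul] at this
    linarith
  have hneg : ∀ a, -1 ≤ a → a ≤ 0 →
      ∫ t in a..1, tent t = 1 / 2 - a - a ^ 2 / 2 := fun a ha ha0 => by
    rw [← intervalIntegral.integral_add_adjacent_intervals (hi a 0) (hi 0 1)]
    have e1 : ∫ t in a..0, tent t = ∫ t in a..0, ((1 + a) + (t - a)) := by
      refine intervalIntegral.integral_congr fun t ht => ?_
      rw [uIcc_of_le ha0] at ht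
      have : |t| = -t := abs_of_nonpos ht.2
      rw [tent_of_abs_le_one (by rw [this]; linarith [ht.1]), this]
      ring
    have e2 : ∫ t in (0 : ℝ)..1, tent t = ∫ t in (0 : ℝ)..1, (0 + (1 - t)) := by
      refine intervalIntegral.integral_congr fun t ht => ?_
      rw [uIcc_of_le zero_le_one] at ht
      have : |t| = t := abs_of_nonneg ht.1
      rw [tent_of_abs_le_one (by rw [this]; exact ht.2), this]
      ring
    rw [e1, e2, integral_const_add_sub_left, integral_const_add_sub_right]
    ring
  rcases le_or_gt (√2 - 1) p with hp1 | hp1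
  · exact hout p 1 hp fun t ht => (hp1.trans ht.1).trans (le_abs_self t)
  have hmid := hneg (-(√2 - 1)) (by linarith) (by linarith)
  rw [← intervalIntegral.integral_add_adjacent_intervals (hi _ p) (hi p 1)] at hmid
  rcases le_or_gt p (-(√2 - 1)) with hp2 | hp2
  · have := hout p (-(√2 - 1)) hp2 fun t ht => by linarith [ht.2, neg_le_abs t]
    rw [intervalIntegral.integral_symm] at this
    nlinarith
  · have := intervalIntegral.integral_mono_on hp2.le intervalIntegrable_const (hi _ p)
      (f := fun _ => 1 - (√2 - 1)) fun t ht => by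
        have : |t| ≤ √2 - 1 := abs_le.2 ⟨ht.1, ht.2.trans hp1.le⟩
        rw [tent_of_abs_le_one (by linarith)]
        linarith
    rw [intervalIntegral.integral_const, smul_eq_mul] at this
    nlinarith

theorem average_abs_tent {p q : ℝ} (hpq : p < q) :
    ⨍ t in Icc p q, |tent t| = (∫ t in p..q, tent t) / (q - p) := by
  simp_rw [abs_of_nonneg (tent_nonneg _)]
  exact setAverage_Icc_eq_div _ hpq

theorem maxR_tent_one_le : maxR tent 1 ≤ 1 - (√2 - 1) := by
  have h3 : √2 < 2 := by rw [Real.sqrt_lt'] <;> norm_num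
  refine csSup_le (averagesAt_nonempty tent 1) ?_
  rintro a ⟨p, q, hpq, hmem, rfl⟩
  rw [average_abs_tent hpq, div_le_iff₀ (sub_pos.2 hpq),
    ← intervalIntegral.integral_add_adjacent_intervals (continuous_tent.intervalIntegrable p 1)
      (continuous_tent.intervalIntegrable 1 q)]
  have hl := integral_tent_le_of_le_one hmem.1
  have hr := intervalIntegral.integral_mono_on hmem.2 (continuous_tent.intervalIntegrable 1 q)
    (intervalIntegrable_const (μ := volume)) fun t ht =>
      tent_le (c := √2 - 1) (by linarith) (by linarith [ht.1, le_abs_self t])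
  rw [intervalIntegral.integral_const, smul_eq_mul] at hr
  linarith

theorem one_le_maxR_tent_zero : 1 ≤ maxR tent 0 := by
  have hb : BddAbove (averagesAt tent 0) := by
    refine ⟨1, ?_⟩
    rintro a ⟨p, q, hpq, -, rfl⟩
    rw [average_abs_tent hpq, div_le_iff₀ (sub_pos.2 hpq)]
    have := intervalIntegral.integral_mono_on hpq.le (continuous_tent.intervalIntegrable p q)
      (intervalIntegrable_const (μ := volume)) fun t _ => tent_le zero_le_one (abs_nonneg t)
    rw [intervalIntegral.integral_const, smul_eq_mul] at this
    linarith
  refine le_of_forall_pos_le_add fun ε hε => ?_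
  have h := le_csSup hb ⟨0, ε, hε, ⟨le_rfl, hε.le⟩, rfl⟩
  have hl := le_integral_of_left (g := tent) (by simpa using abs_tent_sub_tent_le) hε.le
  rw [average_abs_tent hε, div_le_iff₀ (by linarith)] at h
  have h0 : tent 0 = 1 := by simp [tent]
  rw [h0] at hl
  change _ ≤ maxR tent 0 * _ at h
  nlinarith

theorem lipR_maxR_tent : lipR (maxR tent) = √2 - 1 := by
  refine le_antisymm (by simpa [lipR_tent] using lipR_maxR_le abs_tent_sub_tent_le) ?_
  have h := div_le_lipR (abs_maxR_sub_maxR_le one_pos abs_tent_sub_tent_le) (zero_ne_one (α := ℝ))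
  refine le_trans ?_ h
  rw [zero_sub, abs_neg, abs_one, div_one]
  exact le_trans (by linarith [maxR_tent_one_le, one_le_maxR_tent_zero]) (le_abs_self _)

/-- On Lipschitz functions of `ℝ`, the uncentered maximal operator has operator norm
`√2 − 1`: `Lip(Mf) ≤ (√2 − 1) Lip(f)` for every Lipschitz `f`, and
`√2 − 1 = sup { Lip(Mf) : Lip(f) = 1 }`. -/
theorem stmt11 :
    (∀ f : ℝ → ℝ, (∃ C : ℝ, ∀ x y, |f x - f y| ≤ C * |x - y|) →
      lipR (maxR f) ≤ (Real.sqrt 2 - 1) * lipR f) ∧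
    sSup {a : ℝ | ∃ f : ℝ → ℝ, lipR f = 1 ∧ a = lipR (maxR f)} = Real.sqrt 2 - 1 := by
  refine ⟨fun f ⟨C, hf⟩ => lipR_maxR_le hf, IsGreatest.csSup_eq ⟨?_, ?_⟩⟩
  · exact ⟨tent, lipR_tent, lipR_maxR_tent.symm⟩
  · rintro a ⟨f, hf, rfl⟩
    simpa [hf] using lipR_maxR_le (abs_sub_le_of_lipR_eq_one hf)
end

section
/- Let d ≥ 2, let f : [0,∞) → [0,∞) be an increasing function, and let 1 ≤ p < ∞. Then for all R > 0, all c = (c₁, …, c_d) ∈ ℝ^d, and all a ∈ ℝ with |a| ≤ |c₁|, one has ∫_{B_p(a e₁, R)} f(‖x‖_p^p) dλ(x) ≤ ∫_{B_p(c, R)} f(‖x‖_p^p) dλ(x), where B_p(z, R) denotes the ℓ_p ball of center z and radius R in ℝ^d and λ is d-dimensional Lebesgue measure. -/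
open MeasureTheory Set

/-- The `ℓ_p` norm on `ℝ^d`. -/
noncomputable def lpNorm {d : ℕ} (p : ℝ) (x : Fin d → ℝ) : ℝ :=
  (∑ i, |x i| ^ p) ^ (1 / p)

/-- The closed `ℓ_p` ball of center `z` and radius `R` in `ℝ^d`. -/
noncomputable def lpBall {d : ℕ} (p : ℝ) (z : Fin d → ℝ) (R : ℝ) : Set (Fin d → ℝ) :=
  {x | lpNorm p (x - z) ≤ R}

theorem lpBall_subset_closedBall {d : ℕ} {p : ℝ} (hp : 0 < p) (z : Fin d → ℝ) {R : ℝ}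
    (hR : 0 ≤ R) : lpBall p z R ⊆ Metric.closedBall z R := by
  intro x hx
  rw [Metric.mem_closedBall, dist_pi_le_iff hR]
  intro i
  have h0 : ∀ j, 0 ≤ |(x - z) j| ^ p := fun j => by positivity
  refine le_trans ?_ (show lpNorm p (x - z) ≤ R from hx)
  calc dist (x i) (z i) = (|(x - z) i| ^ p) ^ (1 / p) := by
        rw [one_div, Real.rpow_rpow_inv (abs_nonneg _) hp.ne', Real.dist_eq, Pi.sub_apply]
    _ ≤ lpNorm p (x - z) :=
        Real.rpow_le_rpow (h0 i) (Finset.single_le_sum (fun j _ => h0 j) (Finset.mem_univ i))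
          (by positivity)

theorem measurable_lpNorm_sub {d : ℕ} (p : ℝ) (z : Fin d → ℝ) :
    Measurable fun x : Fin d → ℝ => lpNorm p (x - z) := by
  unfold _root_.lpNorm
  simp only [Pi.sub_apply]
  fun_prop

theorem measurableSet_lpBall {d : ℕ} (p : ℝ) (z : Fin d → ℝ) (R : ℝ) :
    MeasurableSet (lpBall p z R) :=
  measurableSet_le (measurable_lpNorm_sub p z) measurable_const

theorem integrableOn_lpBall {d : ℕ} {p : ℝ} (hp : 0 < p) {f : ℝ → ℝ}
    (hf_nonneg : ∀ x, 0 ≤ x → 0 ≤ f x) (hf_mono : MonotoneOn f (Set.Ici 0))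
    (z : Fin d → ℝ) {R : ℝ} (hR : 0 ≤ R) :
    IntegrableOn (fun x => f (∑ i, |x i| ^ p)) (lpBall p z R) := by
  have hsum : ∀ x : Fin d → ℝ, 0 ≤ ∑ i, |x i| ^ p := fun x => by positivity
  have hmeas : Measurable fun x : Fin d → ℝ => f (∑ i, |x i| ^ p) := by
    have hg : Monotone fun t => f (max t 0) := fun s t hst =>
      hf_mono (le_max_right s 0) (le_max_right t 0) (max_le_max_right 0 hst)
    have hs : Measurable fun x : Fin d → ℝ => ∑ i, |x i| ^ p := by fun_prop
    convert hg.measurable.comp hs using 2 with x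
    exact congrArg f (max_eq_left (hsum x)).symm
  have hcont : Continuous fun x : Fin d → ℝ => ∑ i, |x i| ^ p :=
    continuous_finsetSum _ fun i _ =>
      (continuous_apply i).abs.rpow_const fun _ => Or.inr hp.le
  obtain ⟨M, hM⟩ := (isCompact_closedBall z R).exists_bound_of_continuousOn hcont.continuousOn
  have hball : IntegrableOn (fun x => f (∑ i, |x i| ^ p)) (Metric.closedBall z R) := by
    refine Measure.integrableOn_of_bounded (M := f M) measure_closedBall_lt_top.ne
      hmeas.aestronglyMeasurable ?_
    refine (ae_restrict_iff' measurableSet_closedBall).2 (Filter.Eventually.of_forall ?_)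
    intro x hx
    have hle := (le_abs_self _).trans (hM x hx)
    rw [Real.norm_of_nonneg (hf_nonneg _ (hsum x))]
    exact hf_mono (hsum x) ((hsum x).trans hle) hle
  exact hball.mono_set (lpBall_subset_closedBall hp z hR)

/-- Replacing the `i`-th coordinate `t` by `s - t`. -/
def reflectCoord {d : ℕ} (i : Fin d) (s : ℝ) (x : Fin d → ℝ) : Fin d → ℝ :=
  Function.update x i (s - x i)

theorem reflectCoord_involutive {d : ℕ} (i : Fin d) (s : ℝ) :
    Function.Involutive (reflectCoord i s) := by
  intro x
  simp [reflectCoord]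

theorem measurePreserving_reflectCoord {d : ℕ} (i : Fin d) (s : ℝ) :
    MeasurePreserving (reflectCoord i s) := by
  have h : ∀ j, MeasurePreserving (fun t : ℝ => if j = i then s - t else t) := by
    intro j
    by_cases hj : j = i
    · simpa [hj] using Measure.measurePreserving_sub_left volume s
    · simp only [hj, if_false]
      exact MeasurePreserving.id volume
  convert volume_preserving_pi h using 1
  ext x j
  by_cases hj : j = i
  · subst hj; simp [reflectCoord]
  · simp [reflectCoord, hj]

theorem measurableEmbedding_reflectCoord {d : ℕ} (i : Fin d) (s : ℝ) :
    MeasurableEmbedding (reflectCoord i s) :=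
  (MeasurableEquiv.ofInvolutive _ (reflectCoord_involutive i s)
    (measurePreserving_reflectCoord i s).measurable).measurableEmbedding

theorem lpNorm_reflectCoord_sub {d : ℕ} (p : ℝ) (i : Fin d) (s : ℝ) (x z : Fin d → ℝ) :
    lpNorm p (reflectCoord i s x - z) = lpNorm p (x - reflectCoord i s z) := by
  unfold _root_.lpNorm
  congr 1
  refine Finset.sum_congr rfl fun j _ => ?_
  by_cases hj : j = i
  · subst hj
    simp only [reflectCoord, Pi.sub_apply, Function.update_self]
    rw [← abs_neg]
    ring_nf
  · simp [reflectCoord, hj]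

theorem abs_le_abs_sub_of_abs_sub_lt {a c t : ℝ} (hac : |a| ≤ |c|) (h : |t - a| < |t - c|) :
    |t| ≤ |a + c - t| := by
  have h1 := sq_le_sq.2 hac
  have h2 := sq_lt_sq.2 h
  apply sq_le_sq.1
  rcases lt_trichotomy a c with hlt | rfl | hlt
  · have h3 : 0 ≤ c + a := by nlinarith
    have h4 : 0 < a + c - 2 * t := by nlinarith
    nlinarith
  · exact absurd h (lt_irrefl _)
  · have h3 : c + a ≤ 0 := by nlinarith
    have h4 : a + c - 2 * t < 0 := by nlinarith
    nlinarith

theorem setIntegral_lpBall_update_le {d : ℕ} {p : ℝ} (hp : 0 < p) {f : ℝ → ℝ}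
    (hf_nonneg : ∀ x, 0 ≤ x → 0 ≤ f x) (hf_mono : MonotoneOn f (Set.Ici 0))
    {R : ℝ} (hR : 0 ≤ R) (z : Fin d → ℝ) (i : Fin d) {a : ℝ} (ha : |a| ≤ |z i|) :
    ∫ x in lpBall p (Function.update z i a) R, f (∑ j, |x j| ^ p) ≤
      ∫ x in lpBall p z R, f (∑ j, |x j| ^ p) := by
  set A := lpBall p (Function.update z i a) R
  set B := lpBall p z R
  set T := reflectCoord i (a + z i)
  set F : (Fin d → ℝ) → ℝ := fun x => f (∑ j, |x j| ^ p)
  have hA : MeasurableSet A := measurableSet_lpBall _ _ _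
  have hB : MeasurableSet B := measurableSet_lpBall _ _ _
  have hFA : IntegrableOn F A := integrableOn_lpBall hp hf_nonneg hf_mono _ hR
  have hFB : IntegrableOn F B := integrableOn_lpBall hp hf_nonneg hf_mono _ hR
  have hTz : T z = Function.update z i a := by simp [T, reflectCoord]
  have hTB : T ⁻¹' B = A := by
    ext x
    change lpNorm p (T x - z) ≤ R ↔ lpNorm p (x - Function.update z i a) ≤ R
    rw [lpNorm_reflectCoord_sub, ← hTz]
  have hTA : T ⁻¹' A = B := by
    rw [← hTB, ← preimage_comp, (reflectCoord_involutive i _).comp_self, preimage_id]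
  have hT : MeasurePreserving T := measurePreserving_reflectCoord i _
  have hTe : MeasurableEmbedding T := measurableEmbedding_reflectCoord i _
  have hpre : T ⁻¹' (B \ A) = A \ B := by rw [preimage_sdiff, hTA, hTB]
  have hdiff : ∫ x in A \ B, F x ≤ ∫ x in B \ A, F x := by
    rw [← hT.setIntegral_preimage_emb hTe F (B \ A), hpre]
    refine setIntegral_mono_on (hFA.mono_set sdiff_subset) ?_ (hA.diff hB) ?_
    · rw [← hpre]
      exact (hT.integrableOn_comp_preimage hTe).2 (hFB.mono_set sdiff_subset)
    · rintro x ⟨hxA, hxB⟩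
      have hlt : |x i - a| < |x i - z i| := by
        by_contra! hle
        refine hxB (le_trans ?_ (show lpNorm p (x - Function.update z i a) ≤ R from hxA))
        refine Real.rpow_le_rpow (by positivity) (Finset.sum_le_sum fun j _ => ?_) (by positivity)
        by_cases hj : j = i
        · subst hj
          simpa using Real.rpow_le_rpow (abs_nonneg _) hle hp.le
        · simp [hj]
      refine hf_mono (mem_Ici.2 (by positivity)) (mem_Ici.2 (by positivity))
        (Finset.sum_le_sum fun j _ => ?_)
      by_cases hj : j = i
      · subst hj
        simpa [T, reflectCoord] using
          Real.rpow_le_rpow (abs_nonneg _) (abs_le_abs_sub_of_abs_sub_lt ha hlt) hp.le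
      · simp [T, reflectCoord, hj]
  rw [← integral_inter_add_sdiff hB hFA, ← integral_inter_add_sdiff hA hFB, inter_comm B A]
  gcongr

theorem setIntegral_lpBall_mono {d : ℕ} {p : ℝ} (hp : 0 < p) {f : ℝ → ℝ}
    (hf_nonneg : ∀ x, 0 ≤ x → 0 ≤ f x) (hf_mono : MonotoneOn f (Set.Ici 0))
    {R : ℝ} (hR : 0 ≤ R) {w z : Fin d → ℝ} (hwz : ∀ i, |w i| ≤ |z i|) :
    ∫ x in lpBall p w R, f (∑ j, |x j| ^ p) ≤ ∫ x in lpBall p z R, f (∑ j, |x j| ^ p) := by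
  have key : ∀ s : Finset (Fin d),
      ∫ x in lpBall p (s.piecewise w z) R, f (∑ j, |x j| ^ p) ≤
        ∫ x in lpBall p z R, f (∑ j, |x j| ^ p) := by
    intro s
    induction s using Finset.induction_on with
    | empty => simp
    | insert i s hi ih =>
      rw [Finset.piecewise_insert]
      refine (setIntegral_lpBall_update_le hp hf_nonneg hf_mono hR _ i ?_).trans ih
      simpa [hi] using hwz i
  simpa using key Finset.univ

/-- If `f : [0,∞) → [0,∞)` is increasing, `1 ≤ p < ∞`, `R > 0`, and `|a| ≤ |c₁|`, then the
integral of `f(‖x‖_p^p)` over the `ℓ_p` ball `B_p(a e₁, R)` is at most the integral over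
`B_p(c, R)`. -/
theorem stmt14 (d : ℕ) (hd : 2 ≤ d) (p : ℝ) (hp : 1 ≤ p)
    (f : ℝ → ℝ) (hf_nonneg : ∀ x, 0 ≤ x → 0 ≤ f x) (hf_mono : MonotoneOn f (Set.Ici 0))
    (R : ℝ) (hR : 0 < R) (c : Fin d → ℝ) (a : ℝ)
    (ha : |a| ≤ |c ⟨0, by omega⟩|) :
    ∫ x in lpBall p (Pi.single (⟨0, by omega⟩ : Fin d) a) R, f (∑ i, |x i| ^ p) ≤
      ∫ x in lpBall p c R, f (∑ i, |x i| ^ p) := by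
  refine setIntegral_lpBall_mono (by linarith) hf_nonneg hf_mono hR.le fun i => ?_
  by_cases hi : i = ⟨0, by omega⟩
  · subst hi
    simpa using ha
  · simp [hi]
end
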